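/- Let Δ be the genus-2 metric graph consisting of two loops, the first of length 4δ (δ > 0) attached at vertex a and the second attached at vertex b, with a and b joined by a bridge edge. Let p be the point on the first loop at distance δ from a along one arc (hence at distance 3δ along the other arc). Then p is not a Weierstrass point of Δ, i.e., rk(2·[p]) = 0. -/

import Mathlib

open scoped Classical

noncomputable section

/-! ## Combinatorial models of metric graphs and their topological realizations -/

/-- A combinatorial model of a metric graph: a finite multigraph with positive
edge lengths. -/
structure CombGraph : Type 1 where
  V : Type
  E : Type
  fintypeV : Fintype V
  fintypeE : Fintype E
  src : E → V
  tgt : E → V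
  len : E → ℝ
  len_pos : ∀ e, 0 < len e

attribute [instance] CombGraph.fintypeV CombGraph.fintypeE

namespace CombGraph

variable (G : CombGraph)

instance : TopologicalSpace G.V := ⊥
instance : TopologicalSpace G.E := ⊥

/-- The disjoint union of the vertices and of the edges seen as real intervals,
before gluing. -/
def Pre : Type := G.V ⊕ (G.E × ℝ)

instance : TopologicalSpace G.Pre := inferInstanceAs (TopologicalSpace (G.V ⊕ (G.E × ℝ)))

/-- The predicate selecting legitimate points: a point of an edge `e` must have its
coordinate in `[0, len e]`. -/
def Ok : G.Pre → Prop
  | Sum.inl _ => True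
  | Sum.inr p => 0 ≤ p.2 ∧ p.2 ≤ G.len p.1

/-- Points of the model before gluing. -/
def PreR : Type := {p : G.Pre // G.Ok p}

instance : TopologicalSpace G.PreR := inferInstanceAs (TopologicalSpace {p : G.Pre // G.Ok p})

/-- The gluing relation: the endpoints of each edge are glued to the corresponding
vertices. -/
inductive Glue : G.PreR → G.PreR → Prop
  | srcGlue (e : G.E) :
      Glue ⟨Sum.inl (G.src e), trivial⟩ ⟨Sum.inr (e, 0), ⟨le_refl 0, (G.len_pos e).le⟩⟩
  | tgtGlue (e : G.E) :
      Glue ⟨Sum.inl (G.tgt e), trivial⟩ ⟨Sum.inr (e, G.len e), ⟨(G.len_pos e).le, le_refl _⟩⟩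

/-- The topological realization of the combinatorial model: the underlying
topological space of the associated metric graph. -/
def Space : Type := Quot G.Glue

instance : TopologicalSpace G.Space := inferInstanceAs (TopologicalSpace (Quot G.Glue))

/-- The point of the realization corresponding to a vertex. -/
def vertexPt (v : G.V) : G.Space := Quot.mk _ ⟨Sum.inl v, trivial⟩

/-- Clamping of a real coordinate into `[0, len e]`. -/
def clamp (e : G.E) (t : ℝ) : ℝ := max 0 (min t (G.len e))

/-- The point of the realization lying on the edge `e` at coordinate `t`
(the coordinate is clamped into `[0, len e]`). -/
def edgePt (e : G.E) (t : ℝ) : G.Space :=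
  Quot.mk _ ⟨Sum.inr (e, G.clamp e t),
    ⟨le_max_left 0 _, max_le (G.len_pos e).le (min_le_right _ _)⟩⟩

/-- The genus (first Betti number) of the (connected) metric graph. -/
def genus : ℤ := (Fintype.card G.E : ℤ) - (Fintype.card G.V : ℤ) + 1

/-! ### Outgoing directions, valence -/

/-- `d = (e, b)` is an outgoing unit tangent direction at the point `x`:
if `b = true` it points in the direction of increasing coordinate on `e`, if
`b = false` in the direction of decreasing coordinate. -/
def IsDir (x : G.Space) (d : G.E × Bool) : Prop :=
  if d.2 then ∃ t, 0 ≤ t ∧ t < G.len d.1 ∧ x = G.edgePt d.1 t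
  else ∃ t, 0 < t ∧ t ≤ G.len d.1 ∧ x = G.edgePt d.1 t

/-- The (finite) set of outgoing directions at a point. -/
def dirSet (x : G.Space) : Finset (G.E × Bool) :=
  Finset.univ.filter fun d => G.IsDir x d

/-- The valence of a point of the realization: the number of outgoing
directions at that point. -/
def valence (x : G.Space) : ℕ := (G.dirSet x).card

/-- The coordinate on the edge `d.1` of a point `x` admitting `d` as an outgoing
direction. -/
def dirCoord (x : G.Space) (d : G.E × Bool) : ℝ :=
  if d.2 then
    (if h : ∃ t, 0 ≤ t ∧ t < G.len d.1 ∧ x = G.edgePt d.1 t then h.choose else 0)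
  else
    (if h : ∃ t, 0 < t ∧ t ≤ G.len d.1 ∧ x = G.edgePt d.1 t then h.choose else 0)

/-- The point at distance `u` from `x` in the outgoing direction `d`. -/
def dirPt (x : G.Space) (d : G.E × Bool) (u : ℝ) : G.Space :=
  G.edgePt d.1 (G.dirCoord x d + (if d.2 then u else -u))

end CombGraph

/-! ### Rational functions and divisors -/

/-- A function `g : [0, L] → ℝ` is piecewise integral affine if there is a finite
subdivision of `[0, L]` on whose pieces `g` is affine with integral slope. -/
def PWIntAffine (g : ℝ → ℝ) (L : ℝ) : Prop :=
  ∃ (n : ℕ) (t : ℕ → ℝ) (m : ℕ → ℤ) (b : ℕ → ℝ),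
    t 0 = 0 ∧ t n = L ∧ (∀ i, i < n → t i < t (i + 1)) ∧
    (∀ i, i < n → ∀ u, t i ≤ u → u ≤ t (i + 1) → g u = (m i : ℝ) * u + b i)

/-- A rational function on the metric graph realizing `G`: a continuous function
which is piecewise integral affine on every edge. -/
structure RatFn (G : CombGraph) where
  toFun : G.Space → ℝ
  continuous : Continuous toFun
  piecewise : ∀ e : G.E, PWIntAffine (fun t => toFun (G.edgePt e t)) (G.len e)

namespace CombGraph

variable (G : CombGraph)

/-- The right-hand slope of a rational function on the edge `e` at coordinate `t`. -/
def rightSlope (f : RatFn G) (e : G.E) (t : ℝ) : ℝ :=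
  derivWithin (fun u => f.toFun (G.edgePt e u)) (Set.Ici t) t

/-- The left-hand slope of a rational function on the edge `e` at coordinate `t`. -/
def leftSlope (f : RatFn G) (e : G.E) (t : ℝ) : ℝ :=
  derivWithin (fun u => f.toFun (G.edgePt e u)) (Set.Iic t) t

/-- The order of a rational function at a point: the sum of its outgoing slopes. -/
def ordAt (f : RatFn G) (x : G.Space) : ℝ :=
  if h : ∃ v : G.V, x = G.vertexPt v then
    ∑ e : G.E,
      ((if G.src e = h.choose then G.rightSlope f e 0 else 0)
        + (if G.tgt e = h.choose then -(G.leftSlope f e (G.len e)) else 0))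
  else if h2 : ∃ p : G.E × ℝ, 0 < p.2 ∧ p.2 < G.len p.1 ∧ x = G.edgePt p.1 p.2 then
    G.rightSlope f h2.choose.1 h2.choose.2 - G.leftSlope f h2.choose.1 h2.choose.2
  else 0

/-- The group of divisors of the metric graph: the free abelian group on the
points of the realization. -/
abbrev Div (G : CombGraph) : Type := G.Space →₀ ℤ

/-- The degree of a divisor. -/
def degDiv (D : Div G) : ℤ := D.sum fun _ n => n

/-- A divisor is effective if all of its coefficients are nonnegative. -/
def Effective (D : Div G) : Prop := ∀ x, 0 ≤ D x

/-- `D` is the principal divisor associated to the rational function `f`. -/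
def IsPrincipal (D : Div G) (f : RatFn G) : Prop := ∀ x, (D x : ℝ) = G.ordAt f x

/-- Two divisors are linearly equivalent if their difference is principal. -/
def LinEquiv (D D' : Div G) : Prop := ∃ f : RatFn G, G.IsPrincipal (D - D') f

/-- The Baker–Norine rank of a divisor: the largest integer `k` such that for every
effective divisor `E` of degree `k` the linear system `|D - E|` is nonempty.  (For
negative `k` the condition is vacuous, so the supremum is `-1` exactly when
`|D|` is empty.) -/
def Rk (D : Div G) : ℤ :=
  sSup {k : ℤ | ∀ E : Div G, G.Effective E → G.degDiv E = k →
    ∃ E' : Div G, G.Effective E' ∧ G.LinEquiv (D - E) E'}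

/-- A point of a metric graph is a Weierstrass point if `rk(g·[x]) ≥ 1`. -/
def IsWeierstrass (x : G.Space) : Prop :=
  1 ≤ G.Rk (G.genus • Finsupp.single x 1)

/-- The canonical divisor of a metric graph. -/
def canonical : Div G :=
  ∑ v : G.V, ((G.valence (G.vertexPt v) : ℤ) - 2) • Finsupp.single (G.vertexPt v) 1

end CombGraph

/-- The dumbbell graph of genus `2`: two loops of lengths `L₁` and `L₂`, based at the
vertices `a = 0` and `b = 1`, joined by a bridge edge of length `c`.  Edge `0` is the
first loop, edge `1` the second loop and edge `2` the bridge. -/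
def dumbbell (L₁ L₂ c : ℝ) (h₁ : 0 < L₁) (h₂ : 0 < L₂) (hc : 0 < c) : CombGraph where
  V := Fin 2
  E := Fin 3
  fintypeV := inferInstance
  fintypeE := inferInstance
  src := ![0, 1, 0]
  tgt := ![0, 1, 1]
  len := ![L₁, L₂, c]
  len_pos := by
    intro e
    fin_cases e <;> simpa using ‹_›


open Filter Topology

/-- A continuous function on `[α, β]` which is locally affine on both sides of every point, with
nonincreasing slopes at interior points, lies above its chord. In particular its initial slope is
at least, and its final slope at most, the slope of the chord. -/
theorem end_slopes_of_locally_concave {g R S : ℝ → ℝ} {α β : ℝ} (hαβ : α < β)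
    (hg : Continuous g)
    (hR : ∀ x, α ≤ x → x < β → ∀ᶠ u in 𝓝[>] x, g u = g x + R x * (u - x))
    (hS : ∀ x, α < x → x ≤ β → ∀ᶠ u in 𝓝[<] x, g u = g x + S x * (u - x))
    (hRS : ∀ x, α < x → x < β → R x ≤ S x) :
    S β * (β - α) ≤ g β - g α ∧ g β - g α ≤ R α * (β - α) := by
  set s := (g β - g α) / (β - α) with hs
  have hpos : 0 < β - α := sub_pos.2 hαβ
  have hsm : s * (β - α) = g β - g α := div_mul_cancel₀ _ hpos.ne'
  set φ : ℝ → ℝ := fun u => g u - s * (u - α) with hφ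
  have hφc : Continuous φ := by fun_prop
  have hφα : φ α = g α := by simp [hφ]
  have hφβ : φ β = g α := by simp only [hφ]; linarith
  have above : ∀ u ∈ Set.Icc α β, g α ≤ φ u := by
    obtain ⟨y, hy, hymin⟩ := isCompact_Icc.exists_isMinOn
      (Set.nonempty_Icc.2 hαβ.le) hφc.continuousOn
    have hK : IsCompact (Set.Icc α β ∩ φ ⁻¹' {φ y}) :=
      isCompact_Icc.inter_right (isClosed_singleton.preimage hφc)
    obtain ⟨x, ⟨hx, hxy⟩, hxleast⟩ := hK.exists_isLeast ⟨y, hy, rfl⟩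
    have hxy : φ x = φ y := hxy
    have hmin : ∀ u ∈ Set.Icc α β, φ x ≤ φ u := fun u hu => hxy ▸ hymin hu
    by_contra! hne
    obtain ⟨w, hw, hwlt⟩ := hne
    have hxlt : φ x < g α := (hmin w hw).trans_lt hwlt
    have hαx : α < x := hx.1.lt_of_ne (by rintro rfl; exact hxlt.ne hφα)
    have hxβ : x < β := hx.2.lt_of_ne (by rintro rfl; exact hxlt.ne hφβ)
    obtain ⟨u, hu, hu'⟩ := ((hR x hαx.le hxβ).and (Ioo_mem_nhdsGT hxβ)).exists
    obtain ⟨v, hv, hv'⟩ := ((hS x hαx hxβ.le).and (Ioo_mem_nhdsLT hαx)).exists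
    have h1 := hmin u ⟨hαx.le.trans hu'.1.le, hu'.2.le⟩
    have hvI : v ∈ Set.Icc α β := ⟨hv'.1.le, hv'.2.le.trans hxβ.le⟩
    have h2 := hmin v hvI
    have hRs : s ≤ R x := by
      simp only [hφ, hu] at h1
      by_contra! h
      nlinarith [mul_pos (sub_pos.2 h) (sub_pos.2 hu'.1)]
    have hvne : φ x < φ v := lt_of_le_of_ne h2 fun h =>
      (hxleast ⟨hvI, (h.symm.trans hxy : φ v = φ y)⟩).not_gt hv'.2
    have := hRS x hαx hxβ
    simp only [hφ, hv] at hvne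
    nlinarith [mul_nonneg (sub_nonneg.2 (hRs.trans this)) (sub_pos.2 hv'.2).le]
  constructor
  · obtain ⟨v, hv, hv'⟩ := ((hS β hαβ le_rfl).and (Ioo_mem_nhdsLT hαβ)).exists
    have h := above v ⟨hv'.1.le, hv'.2.le⟩
    rw [← hφβ] at h
    simp only [hφ, hv] at h
    have : S β ≤ s := by
      by_contra! h'
      nlinarith [mul_pos (sub_pos.2 h') (sub_pos.2 hv'.2)]
    rw [← hsm]
    gcongr
  · obtain ⟨u, hu, hu'⟩ := ((hR α le_rfl hαβ).and (Ioo_mem_nhdsGT hαβ)).exists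
    have h := above u ⟨hu'.1.le, hu'.2.le⟩
    simp only [hφ, hu] at h
    have : s ≤ R α := by
      by_contra! h'
      nlinarith [mul_pos (sub_pos.2 h') (sub_pos.2 hu'.1)]
    rw [← hsm]
    gcongr

theorem derivWithin_eq_of_eventually_affine {g : ℝ → ℝ} {s t : Set ℝ} {x m : ℝ}
    (hs : UniqueDiffWithinAt ℝ s x) (hst : s ⊆ insert x t)
    (h : ∀ᶠ u in 𝓝[t] x, g u = g x + m * (u - x)) : derivWithin g s x = m := by
  have haff : HasDerivWithinAt (fun u => g x + m * (u - x)) m (insert x t) x := by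
    simpa using ((((hasDerivAt_id x).sub_const x).const_mul m).const_add (g x)).hasDerivWithinAt
  have h' : g =ᶠ[𝓝[insert x t] x] fun u => g x + m * (u - x) := by
    rw [nhdsWithin_insert]
    exact Filter.mem_sup.2 ⟨by simp, h⟩
  exact ((haff.congr_of_eventuallyEq h' (by simp)).mono hst).derivWithin hs

namespace PWIntAffine

variable {g : ℝ → ℝ} {L x : ℝ}

theorem eventually_right (h : PWIntAffine g L) (h0 : 0 ≤ x) (hx : x < L) :
    ∃ m : ℤ, derivWithin g (Set.Ici x) x = m ∧
      ∀ᶠ u in 𝓝[>] x, g u = g x + m * (u - x) := by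
  obtain ⟨n, t, m, b, ht0, htn, -, hg⟩ := h
  have hex : ∃ j, x < t j := ⟨n, htn ▸ hx⟩
  have hj := Nat.find_spec hex
  have hjn : Nat.find hex ≤ n := Nat.find_min' hex (htn ▸ hx)
  obtain ⟨i, hi⟩ : ∃ i, Nat.find hex = i + 1 := Nat.exists_eq_succ_of_ne_zero fun h => by
    rw [h, ht0] at hj; linarith
  have hle : t i ≤ x := not_lt.1 (Nat.find_min hex (by omega))
  rw [hi] at hj
  have hev : ∀ᶠ u in 𝓝[>] x, g u = g x + m i * (u - x) := by
    filter_upwards [Ioo_mem_nhdsGT hj] with u hu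
    rw [hg i (by omega) u (hle.trans hu.1.le) hu.2.le, hg i (by omega) x hle hj.le]
    ring
  exact ⟨m i, derivWithin_eq_of_eventually_affine (uniqueDiffOn_Ici x x Set.self_mem_Ici)
    (by simp) hev, hev⟩

theorem eventually_left (h : PWIntAffine g L) (h0 : 0 < x) (hx : x ≤ L) :
    ∃ m : ℤ, derivWithin g (Set.Iic x) x = m ∧
      ∀ᶠ u in 𝓝[<] x, g u = g x + m * (u - x) := by
  obtain ⟨n, t, m, b, ht0, htn, -, hg⟩ := h
  have hex : ∃ j, x ≤ t j := ⟨n, htn ▸ hx⟩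
  have hj := Nat.find_spec hex
  have hjn : Nat.find hex ≤ n := Nat.find_min' hex (htn ▸ hx)
  obtain ⟨i, hi⟩ : ∃ i, Nat.find hex = i + 1 := Nat.exists_eq_succ_of_ne_zero fun h => by
    rw [h, ht0] at hj; linarith
  have hlt : t i < x := not_le.1 (Nat.find_min hex (by omega))
  rw [hi] at hj
  have hev : ∀ᶠ u in 𝓝[<] x, g u = g x + m i * (u - x) := by
    filter_upwards [Ioo_mem_nhdsLT hlt] with u hu
    rw [hg i (by omega) u hu.1.le (hu.2.le.trans hj), hg i (by omega) x hlt.le hj]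
    ring
  exact ⟨m i, derivWithin_eq_of_eventually_affine (uniqueDiffOn_Iic x x Set.self_mem_Iic)
    (by simp) hev, hev⟩

end PWIntAffine

namespace CombGraph

variable (G : CombGraph)

theorem clamp_of_mem {e : G.E} {t : ℝ} (h0 : 0 ≤ t) (h1 : t ≤ G.len e) : G.clamp e t = t := by
  simp [clamp, h0, h1]

theorem continuous_edgePt (e : G.E) : Continuous (G.edgePt e) := by
  have hc : Continuous (G.clamp e) := by unfold clamp; fun_prop
  have h1 : Continuous fun t : ℝ => ((e, G.clamp e t) : G.E × ℝ) := by fun_prop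
  have h2 : Continuous fun t : ℝ => (Sum.inr (e, G.clamp e t) : G.V ⊕ (G.E × ℝ)) :=
    continuous_inr.comp h1
  exact continuous_quot_mk.comp (h2.subtype_mk (p := G.Ok) _)

theorem edgePt_zero (e : G.E) : G.edgePt e 0 = G.vertexPt (G.src e) := by
  refine Eq.trans ?_ (Quot.sound (Glue.srcGlue e)).symm
  simp only [edgePt, G.clamp_of_mem le_rfl (G.len_pos e).le]
  rfl

theorem edgePt_len (e : G.E) : G.edgePt e (G.len e) = G.vertexPt (G.tgt e) := by
  refine Eq.trans ?_ (Quot.sound (Glue.tgtGlue e)).symm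
  simp only [edgePt, G.clamp_of_mem (G.len_pos e).le le_rfl]
  rfl

/-- The representative of a point of the realization which is a vertex whenever possible. -/
def normalForm : G.Space → G.V ⊕ (G.E × ℝ) :=
  Quot.lift
    (fun z => match z.1 with
      | Sum.inl v => Sum.inl v
      | Sum.inr p =>
        if p.2 = 0 then Sum.inl (G.src p.1)
        else if p.2 = G.len p.1 then Sum.inl (G.tgt p.1) else Sum.inr p)
    (by
      rintro _ _ (e | e)
      · simp
      · simp [(G.len_pos e).ne'])

theorem normalForm_vertexPt (v : G.V) : G.normalForm (G.vertexPt v) = Sum.inl v := rfl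

theorem normalForm_edgePt {e : G.E} {t : ℝ} (h0 : 0 < t) (h1 : t < G.len e) :
    G.normalForm (G.edgePt e t) = Sum.inr (e, t) := by
  simp [normalForm, edgePt, G.clamp_of_mem h0.le h1.le, h0.ne', h1.ne]

theorem vertexPt_injective : Function.Injective G.vertexPt := fun v w h => by
  simpa [normalForm_vertexPt] using congrArg G.normalForm h

theorem edgePt_ne_vertexPt {e : G.E} {t : ℝ} (h0 : 0 < t) (h1 : t < G.len e) (v : G.V) :
    G.edgePt e t ≠ G.vertexPt v := fun h => by
  simpa [normalForm_vertexPt, G.normalForm_edgePt h0 h1] using congrArg G.normalForm h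

theorem edgePt_inj {e e' : G.E} {t t' : ℝ} (h0 : 0 < t) (h1 : t < G.len e) (h0' : 0 < t')
    (h1' : t' < G.len e') (h : G.edgePt e t = G.edgePt e' t') : (e, t) = (e', t') := by
  simpa [G.normalForm_edgePt h0 h1, G.normalForm_edgePt h0' h1'] using congrArg G.normalForm h

theorem ordAt_vertexPt (f : RatFn G) (v : G.V) :
    G.ordAt f (G.vertexPt v) = ∑ e : G.E,
      ((if G.src e = v then G.rightSlope f e 0 else 0)
        + (if G.tgt e = v then -(G.leftSlope f e (G.len e)) else 0)) := by
  have h : ∃ w : G.V, G.vertexPt v = G.vertexPt w := ⟨v, rfl⟩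
  have hv : h.choose = v := (G.vertexPt_injective h.choose_spec).symm
  rw [ordAt, dif_pos h, hv]

theorem ordAt_edgePt (f : RatFn G) {e : G.E} {t : ℝ} (h0 : 0 < t) (h1 : t < G.len e) :
    G.ordAt f (G.edgePt e t) = G.rightSlope f e t - G.leftSlope f e t := by
  have h : ∃ p : G.E × ℝ, 0 < p.2 ∧ p.2 < G.len p.1 ∧ G.edgePt e t = G.edgePt p.1 p.2 :=
    ⟨(e, t), h0, h1, rfl⟩
  have hp : h.choose = (e, t) :=
    (G.edgePt_inj h0 h1 h.choose_spec.1 h.choose_spec.2.1 h.choose_spec.2.2).symm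
  rw [ordAt, dif_neg fun ⟨v, hv⟩ => G.edgePt_ne_vertexPt h0 h1 v hv, dif_pos h, hp]

theorem rightSlope_integral (f : RatFn G) {e : G.E} {t : ℝ} (h0 : 0 ≤ t) (h1 : t < G.len e) :
    ∃ m : ℤ, G.rightSlope f e t = m :=
  ((f.piecewise e).eventually_right h0 h1).imp fun _ h => h.1

theorem leftSlope_integral (f : RatFn G) {e : G.E} {t : ℝ} (h0 : 0 < t) (h1 : t ≤ G.len e) :
    ∃ m : ℤ, G.leftSlope f e t = m :=
  ((f.piecewise e).eventually_left h0 h1).imp fun _ h => h.1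

/-- On a segment of an edge in whose interior `f` has nonpositive order, the slopes of `f` at the
two ends enclose its mean slope. -/
theorem slope_bounds (f : RatFn G) {e : G.E} {α β : ℝ} (h0 : 0 ≤ α) (hαβ : α < β)
    (h1 : β ≤ G.len e) (hord : ∀ x, α < x → x < β → G.ordAt f (G.edgePt e x) ≤ 0) :
    G.leftSlope f e β * (β - α) ≤ f.toFun (G.edgePt e β) - f.toFun (G.edgePt e α) ∧
      f.toFun (G.edgePt e β) - f.toFun (G.edgePt e α) ≤ G.rightSlope f e α * (β - α) := by
  refine end_slopes_of_locally_concave (g := fun u => f.toFun (G.edgePt e u))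
    (R := G.rightSlope f e) (S := G.leftSlope f e) hαβ
    (f.continuous.comp (G.continuous_edgePt e)) (fun x hx hx' => ?_) (fun x hx hx' => ?_)
    fun x hx hx' => ?_
  · obtain ⟨m, hm, hev⟩ := (f.piecewise e).eventually_right (h0.trans hx) (hx'.trans_le h1)
    rwa [rightSlope, hm]
  · obtain ⟨m, hm, hev⟩ := (f.piecewise e).eventually_left (h0.trans_lt hx) (hx'.trans h1)
    rwa [leftSlope, hm]
  · have := hord x hx hx'
    rw [G.ordAt_edgePt f (h0.trans_lt hx) (hx'.trans_le h1)] at this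
    linarith

/-- The zero function as a rational function. -/
def zeroFn : RatFn G where
  toFun := fun _ => 0
  continuous := continuous_const
  piecewise e := ⟨1, fun i => i * G.len e, 0, 0, by simp, by simp,
    fun i _ => by push_cast; linarith [G.len_pos e], by simp⟩

theorem linEquiv_refl (D : Div G) : G.LinEquiv D D := by
  refine ⟨G.zeroFn, fun x => ?_⟩
  have hr : ∀ e t, G.rightSlope G.zeroFn e t = 0 := fun e t => by simp [rightSlope, zeroFn]
  have hl : ∀ e t, G.leftSlope G.zeroFn e t = 0 := fun e t => by simp [leftSlope, zeroFn]
  simp [ordAt, hr, hl]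

theorem eq_zero_of_effective {E : Div G} (hE : G.Effective E) (h : G.degDiv E = 0) : E = 0 := by
  ext x
  by_cases hx : x ∈ E.support
  · exact (Finset.sum_eq_zero_iff_of_nonneg fun y _ => hE y).1 h x hx
  · simpa using hx

/-- An effective divisor has rank zero as soon as no multiple of some point `q` can be subtracted
from it. -/
theorem rk_eq_zero {D : Div G} (hD : G.Effective D) (q : G.Space)
    (hq : ∀ k : ℤ, 1 ≤ k → ∀ E' : Div G, G.Effective E' →
      ¬ G.LinEquiv (D - Finsupp.single q k) E') : G.Rk D = 0 := by
  refine IsGreatest.csSup_eq ⟨fun E hE hdeg => ?_, fun k hk => ?_⟩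
  · rw [G.eq_zero_of_effective hE hdeg, sub_zero]
    exact ⟨D, hD, G.linEquiv_refl D⟩
  · by_contra! hpos
    have heff : G.Effective (Finsupp.single q k) := fun x => by
      rw [Finsupp.single_apply]; split_ifs <;> omega
    obtain ⟨E', hE', h⟩ := hk _ heff (by simp [degDiv])
    exact hq k (by omega) E' hE' h

section DumbbellShape

variable {G} {e₀ e₁ e₂ : G.E} {δ : ℝ}

/-- Let `e₀` and `e₁` be loops joined by a bridge `e₂`, and let `p` be the point at distance `δ`
along `e₀`, a loop of length `4 * δ`. A rational function whose order is at most `2` at `p` and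
nonpositive elsewhere cannot have negative order at the midpoint of `e₁`. -/
theorem not_ordAt_midpoint_le (hδ : 0 < δ) (hl₀ : G.len e₀ = 4 * δ)
    (hloop₀ : G.tgt e₀ = G.src e₀) (hloop₁ : G.tgt e₁ = G.src e₁) (he₁ : e₁ ≠ e₀) (he₂ : e₂ ≠ e₀)
    (f : RatFn G)
    (ha : G.ordAt f (G.vertexPt (G.src e₀)) =
      G.rightSlope f e₀ 0 - G.leftSlope f e₀ (G.len e₀) + G.rightSlope f e₂ 0)
    (hb : G.ordAt f (G.vertexPt (G.src e₁)) =
      G.rightSlope f e₁ 0 - G.leftSlope f e₁ (G.len e₁) - G.leftSlope f e₂ (G.len e₂))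
    (hp : G.ordAt f (G.edgePt e₀ δ) ≤ 2) (hne : ∀ x, x ≠ G.edgePt e₀ δ → G.ordAt f x ≤ 0) :
    ¬ G.ordAt f (G.edgePt e₁ (G.len e₁ / 2)) ≤ -1 := by
  intro hq
  have hpδ : δ < G.len e₀ := by linarith
  have h₂ := G.len_pos e₁
  have hc := G.len_pos e₂
  have hord : ∀ (e : G.E) (x : ℝ), 0 < x → x < G.len e → (e, x) ≠ (e₀, δ) →
      G.ordAt f (G.edgePt e x) ≤ 0 := fun e x h0 h1 hx =>
    hne _ fun h => hx (G.edgePt_inj h0 h1 hδ hpδ h)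
  have hv : ∀ v : G.V, G.ordAt f (G.vertexPt v) ≤ 0 := fun v =>
    hne _ (G.edgePt_ne_vertexPt hδ hpδ v).symm
  replace ha := ha.symm.trans_le (hv _)
  replace hb := hb.symm.trans_le (hv _)
  rw [hl₀] at ha
  rw [G.ordAt_edgePt f (e := e₀) hδ hpδ] at hp
  rw [G.ordAt_edgePt f (e := e₁) (t := G.len e₁ / 2) (by linarith) (by linarith)] at hq
  have hl₀e : G.edgePt e₀ (4 * δ) = G.edgePt e₀ 0 := by
    rw [← hl₀, G.edgePt_len, G.edgePt_zero, hloop₀]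
  have hl₁e : G.edgePt e₁ (G.len e₁) = G.edgePt e₁ 0 := by
    rw [G.edgePt_len, G.edgePt_zero, hloop₁]
  obtain ⟨hB₁, hA₁⟩ := G.slope_bounds f (e := e₀) le_rfl hδ hpδ.le fun x h0 h1 =>
    hord e₀ x h0 (h1.trans hpδ) fun h => h1.ne (congrArg Prod.snd h)
  obtain ⟨hB₂, hA₂⟩ := G.slope_bounds f (e := e₀) hδ.le (β := 4 * δ) (by linarith) hl₀.ge
    fun x h0 h1 => hord e₀ x (hδ.trans h0) (hl₀ ▸ h1) fun h => h0.ne' (congrArg Prod.snd h)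
  obtain ⟨hB₃, hA₃⟩ := G.slope_bounds f (e := e₁) (α := 0) (β := G.len e₁ / 2) le_rfl (by linarith)
    (by linarith) fun x h0 h1 => hord e₁ x h0 (by linarith) fun h => he₁ (congrArg Prod.fst h)
  obtain ⟨hB₄, hA₄⟩ := G.slope_bounds f (e := e₁) (α := G.len e₁ / 2) (β := G.len e₁) (by linarith)
    (by linarith) le_rfl fun x h0 h1 =>
      hord e₁ x (by linarith) h1 fun h => he₁ (congrArg Prod.fst h)
  obtain ⟨hB₅, hA₅⟩ := G.slope_bounds f (e := e₂) (α := 0) (β := G.len e₂) le_rfl hc le_rfl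
    fun x h0 h1 => hord e₂ x h0 h1 fun h => he₂ (congrArg Prod.fst h)
  rw [hl₀e] at hB₂ hA₂
  rw [hl₁e] at hB₄ hA₄
  have hbridge : G.leftSlope f e₂ (G.len e₂) ≤ G.rightSlope f e₂ 0 :=
    le_of_mul_le_mul_right (hB₅.trans hA₅) (by linarith)
  obtain ⟨A, hA⟩ := G.rightSlope_integral f (e := e₁) (t := 0) le_rfl h₂
  obtain ⟨B, hB⟩ := G.leftSlope_integral f (e := e₁) (t := G.len e₁) h₂ le_rfl
  obtain ⟨u, hu⟩ := G.rightSlope_integral f (e := e₀) (t := 0) le_rfl (G.len_pos _)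
  set w := f.toFun (G.edgePt e₁ (G.len e₁ / 2)) - f.toFun (G.edgePt e₁ 0) with hw
  have hwpos : 0 < w := by
    by_contra! h
    nlinarith
  rw [hA] at hA₃ hb
  rw [hB] at hB₄ hb
  have hA1 : 1 ≤ A := by
    have : (0 : ℝ) < A := by
      by_contra! h
      nlinarith
    exact_mod_cast this
  have hB1 : B ≤ -1 := by
    have : (B : ℝ) < 0 := by
      by_contra! h
      nlinarith
    have : B < 0 := by exact_mod_cast this
    omega
  have hA1' : (1 : ℝ) ≤ A := by exact_mod_cast hA1
  have hB1' : (B : ℝ) ≤ -1 := by exact_mod_cast hB1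
  set h := f.toFun (G.edgePt e₀ δ) - f.toFun (G.edgePt e₀ 0) with hh
  obtain ⟨y, hy⟩ : ∃ y, h = y * δ := ⟨h / δ, by field_simp⟩
  have i1 : y ≤ G.rightSlope f e₀ 0 := by
    refine le_of_mul_le_mul_right ?_ hδ; linarith
  have i2 : G.leftSlope f e₀ δ ≤ y := by
    refine le_of_mul_le_mul_right ?_ hδ; linarith
  have i3 : -y ≤ 3 * G.rightSlope f e₀ δ := by
    refine le_of_mul_le_mul_right ?_ hδ; linarith
  have i4 : 3 * G.leftSlope f e₀ (4 * δ) ≤ -y := by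
    refine le_of_mul_le_mul_right ?_ hδ; linarith
  have hu2 : (2 * u : ℝ) = -3 := by
    rw [← hu]
    linarith
  have : 2 * u = -3 := by exact_mod_cast hu2
  omega

/-- In the situation of `not_ordAt_midpoint_le`, the divisor `2 • p` has rank zero. -/
theorem rk_two_single_eq_zero (hδ : 0 < δ) (hl₀ : G.len e₀ = 4 * δ)
    (hloop₀ : G.tgt e₀ = G.src e₀) (hloop₁ : G.tgt e₁ = G.src e₁) (he₁ : e₁ ≠ e₀) (he₂ : e₂ ≠ e₀)
    (ha : ∀ f, G.ordAt f (G.vertexPt (G.src e₀)) =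
      G.rightSlope f e₀ 0 - G.leftSlope f e₀ (G.len e₀) + G.rightSlope f e₂ 0)
    (hb : ∀ f, G.ordAt f (G.vertexPt (G.src e₁)) =
      G.rightSlope f e₁ 0 - G.leftSlope f e₁ (G.len e₁) - G.leftSlope f e₂ (G.len e₂)) :
    G.Rk (Finsupp.single (G.edgePt e₀ δ) 2) = 0 := by
  have h₂ := G.len_pos e₁
  refine G.rk_eq_zero (fun x => ?_) (G.edgePt e₁ (G.len e₁ / 2)) ?_
  · rw [Finsupp.single_apply]
    split_ifs <;> norm_num
  · rintro k hk E' hE' ⟨f, hf⟩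
    have hpq : G.edgePt e₁ (G.len e₁ / 2) ≠ G.edgePt e₀ δ := fun h =>
      he₁ (congrArg Prod.fst (G.edgePt_inj (half_pos h₂) (half_lt_self h₂) hδ (by linarith) h))
    refine not_ordAt_midpoint_le hδ hl₀ hloop₀ hloop₁ he₁ he₂ f (ha f) (hb f) ?_
      (fun x hx => ?_) ?_
    · rw [← hf]
      have := hE' (G.edgePt e₀ δ)
      simp only [Finsupp.sub_apply, Finsupp.single_eq_same, Finsupp.single_eq_of_ne hpq.symm,
        sub_zero]
      exact_mod_cast (by omega : 2 - E' (G.edgePt e₀ δ) ≤ 2)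
    · rw [← hf]
      have := hE' x
      have hk' : 0 ≤ (Finsupp.single (G.edgePt e₁ (G.len e₁ / 2)) k) x := by
        rw [Finsupp.single_apply]; split_ifs <;> omega
      simp only [Finsupp.sub_apply, Finsupp.single_eq_of_ne hx]
      exact_mod_cast (by omega)
    · rw [← hf]
      have := hE' (G.edgePt e₁ (G.len e₁ / 2))
      simp only [Finsupp.sub_apply, Finsupp.single_eq_same, Finsupp.single_eq_of_ne hpq]
      exact_mod_cast (by omega)

end DumbbellShape

end CombGraph

/-- Statement 18: on the genus-`2` dumbbell graph whose first loop has length `4δ`,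
the point `p` of the first loop at distance `δ` from `a` along one arc (hence `3δ`
along the other) is not a Weierstrass point: `rk(2·[p]) = 0`. -/
theorem dumbbell_not_weierstrass (δ L₂ c : ℝ) (hδ : 0 < δ) (h₂ : 0 < L₂) (hc : 0 < c) :
    ¬ (dumbbell (4 * δ) L₂ c (mul_pos four_pos hδ) h₂ hc).IsWeierstrass
        ((dumbbell (4 * δ) L₂ c (mul_pos four_pos hδ) h₂ hc).edgePt (0 : Fin 3) δ) ∧
    (dumbbell (4 * δ) L₂ c (mul_pos four_pos hδ) h₂ hc).Rk
        ((2 : ℤ) • Finsupp.single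
          ((dumbbell (4 * δ) L₂ c (mul_pos four_pos hδ) h₂ hc).edgePt (0 : Fin 3) δ) 1) = 0 := by
  have key : (dumbbell (4 * δ) L₂ c (mul_pos four_pos hδ) h₂ hc).Rk
      ((2 : ℤ) • Finsupp.single
        ((dumbbell (4 * δ) L₂ c (mul_pos four_pos hδ) h₂ hc).edgePt (0 : Fin 3) δ) 1) = 0 := by
    rw [Finsupp.smul_single, smul_eq_mul, mul_one]
    refine CombGraph.rk_two_single_eq_zero (e₁ := (1 : Fin 3)) (e₂ := (2 : Fin 3)) hδ rfl rfl rfl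
      (by decide : (1 : Fin 3) ≠ 0) (by decide : (2 : Fin 3) ≠ 0) (fun f => ?_) (fun f => ?_)
    all_goals
      rw [CombGraph.ordAt_vertexPt]
      refine (Fin.sum_univ_three (M := ℝ) _).trans ?_
      simp [dumbbell, sub_eq_add_neg]
  refine ⟨fun h => ?_, key⟩
  have hgenus : (dumbbell (4 * δ) L₂ c (mul_pos four_pos hδ) h₂ hc).genus = 2 := rfl
  rw [CombGraph.IsWeierstrass, hgenus, key] at h
  exact absurd h (by norm_num)
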